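/- The set R = ℤ × ℂˣ, equipped with the addition (n,a) + (m,b) = (n+m, ab) and the multiplication (n,a) · (m,b) = (nm, aᵐbⁿ), is a commutative ring, with additive unit (0,1), multiplicative unit (1,1), and additive inverse of (n,a) given by (−n, a⁻¹). -/

import Mathlib

/-- The sum `(n,a) + (m,b) = (n+m, ab)` on `ℤ × ℂˣ`. -/
def radd (x y : ℤ × ℂˣ) : ℤ × ℂˣ := (x.1 + y.1, x.2 * y.2)

/-- The product `(n,a) · (m,b) = (nm, aᵐbⁿ)` on `ℤ × ℂˣ`. -/
def rmul (x y : ℤ × ℂˣ) : ℤ × ℂˣ := (x.1 * y.1, x.2 ^ y.1 * y.2 ^ x.1)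

/-- The additive unit `(0,1)`. -/
def rzero : ℤ × ℂˣ := (0, 1)

/-- The multiplicative unit `(1,1)`. -/
def rone : ℤ × ℂˣ := (1, 1)

/-- The additive inverse `(n,a) ↦ (−n, a⁻¹)`. -/
def rneg (x : ℤ × ℂˣ) : ℤ × ℂˣ := (-x.1, x.2⁻¹)

theorem radd_assoc (x y z : ℤ × ℂˣ) : radd (radd x y) z = radd x (radd y z) :=
  Prod.ext (add_assoc _ _ _) (mul_assoc _ _ _)

theorem radd_comm (x y : ℤ × ℂˣ) : radd x y = radd y x :=
  Prod.ext (add_comm _ _) (mul_comm _ _)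

theorem rzero_radd (x : ℤ × ℂˣ) : radd rzero x = x :=
  Prod.ext (zero_add _) (one_mul _)

theorem rneg_radd_cancel (x : ℤ × ℂˣ) : radd (rneg x) x = rzero :=
  Prod.ext (neg_add_cancel _) (inv_mul_cancel _)

theorem rmul_comm (x y : ℤ × ℂˣ) : rmul x y = rmul y x :=
  Prod.ext (mul_comm _ _) (mul_comm _ _)

theorem rmul_assoc (x y z : ℤ × ℂˣ) : rmul (rmul x y) z = rmul x (rmul y z) := by
  refine Prod.ext (mul_assoc _ _ _) ?_
  simp only [rmul, mul_zpow, ← zpow_mul, mul_assoc, mul_comm x.1]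

theorem rone_rmul (x : ℤ × ℂˣ) : rmul rone x = x := by
  simp [rmul, rone]

theorem rmul_radd (x y z : ℤ × ℂˣ) : rmul x (radd y z) = radd (rmul x y) (rmul x z) := by
  refine Prod.ext (mul_add _ _ _) ?_
  simp only [rmul, radd, zpow_add, mul_zpow, mul_mul_mul_comm]

theorem radd_rmul (x y z : ℤ × ℂˣ) : rmul (radd x y) z = radd (rmul x z) (rmul y z) := by
  rw [rmul_comm, rmul_radd, rmul_comm z x, rmul_comm z y]

/-- The set `R = ℤ × ℂˣ`, equipped with the addition `(n,a) + (m,b) = (n+m, ab)`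
and the multiplication `(n,a) · (m,b) = (nm, aᵐbⁿ)`, is a commutative ring, with
additive unit `(0,1)`, multiplicative unit `(1,1)`, and additive inverse of
`(n,a)` given by `(−n, a⁻¹)`. -/
theorem commRing_int_units_complex :
    (∀ x y z : ℤ × ℂˣ, radd (radd x y) z = radd x (radd y z)) ∧
    (∀ x y : ℤ × ℂˣ, radd x y = radd y x) ∧
    (∀ x : ℤ × ℂˣ, radd rzero x = x) ∧
    (∀ x : ℤ × ℂˣ, radd x rzero = x) ∧
    (∀ x : ℤ × ℂˣ, radd (rneg x) x = rzero) ∧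
    (∀ x : ℤ × ℂˣ, radd x (rneg x) = rzero) ∧
    (∀ x y z : ℤ × ℂˣ, rmul (rmul x y) z = rmul x (rmul y z)) ∧
    (∀ x y : ℤ × ℂˣ, rmul x y = rmul y x) ∧
    (∀ x : ℤ × ℂˣ, rmul rone x = x) ∧
    (∀ x : ℤ × ℂˣ, rmul x rone = x) ∧
    (∀ x y z : ℤ × ℂˣ, rmul x (radd y z) = radd (rmul x y) (rmul x z)) ∧
    (∀ x y z : ℤ × ℂˣ, rmul (radd x y) z = radd (rmul x z) (rmul y z)) := by
  exact ⟨radd_assoc, radd_comm, rzero_radd, fun x => (radd_comm _ _).trans (rzero_radd x),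
    rneg_radd_cancel, fun x => (radd_comm _ _).trans (rneg_radd_cancel x),
    rmul_assoc, rmul_comm, rone_rmul, fun x => (rmul_comm _ _).trans (rone_rmul x),
    rmul_radd, radd_rmul⟩
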